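/- Let 1 ≤ q < +∞, q' be the conjugate exponent of q, θ = θ(x,u,t) be continuous, differentiable in x and u, with ∇_x θ and ∇_u θ continuous, and suppose that for every R > 0 there exist C_R > 0 and an a.e. nonnegative ω_R ∈ L^1(0,T) with |θ(x,u,t)| ≤ C_R|u|^q + ω_R(t) for a.e. t ∈ [0,T] and all (x,u) with |x| ≤ R. Then the functional I(x,u) = ∫₀^T θ(x(t),u(t),t) dt is Lipschitz continuous on every bounded subset of L^∞_d(0,T) × L^q_m(0,T) if and only if for every R > 0 there exist C_R > 0 and a.e. nonnegative functions ω_R ∈ L^1(0,T) and η_R ∈ L^{q'}(0,T) such that |∇_x θ(x,u,t)| ≤ C_R|u|^q + ω_R(t) and |∇_u θ(x,u,t)| ≤ C_R|u|^{q−1} + η_R(t) for a.e. t ∈ [0,T] and all (x,u) ∈ ℝ^d×ℝ^m with |x| ≤ R. -/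

import Mathlib

open MeasureTheory Set Filter Topology
open scoped ENNReal NNReal

noncomputable section

/-- `ℝ^n` as a Euclidean space. -/
abbrev Vec (n : ℕ) := EuclideanSpace ℝ (Fin n)

/-- Lebesgue measure restricted to the interval `(0, T]`. -/
noncomputable def muT (T : ℝ) : Measure ℝ := volume.restrict (Set.Ioc 0 T)

/-! ### A Krasnoselskii-type growth bound -/

section Krasnoselskii

variable {P : Type*}

lemma intervalIntegrable_comp_simpleFunc (p : SimpleFunc ℝ P) {Φ : P → ℝ → ℝ}
    (hΦ : ∀ y, Continuous (Φ y)) (a b : ℝ) :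
    IntervalIntegrable (fun t => Φ (p t) t) volume a b := by
  classical
  have hbound : IntervalIntegrable (fun t => ∑ y ∈ p.range, |Φ y t|) volume a b :=
    (continuous_finsetSum _ fun y _ => (hΦ y).abs).intervalIntegrable a b
  refine hbound.mono_fun
    (SimpleFunc.measurable_bind p Φ fun y => (hΦ y).measurable).aestronglyMeasurable ?_
  refine Eventually.of_forall fun t => ?_
  have h1 : |Φ (p t) t| ≤ ∑ y ∈ p.range, |Φ y t| :=
    Finset.single_le_sum (f := fun y => |Φ y t|) (fun y _ => abs_nonneg _)
      (SimpleFunc.mem_range_self p t)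
  simpa only [Real.norm_eq_abs] using h1.trans (le_abs_self _)

/-- If `∫ Φ(p(t),t) dt ≤ K` whenever `∫ w(p(t)) dt ≤ 1`, then cutting the time interval into pieces
of unit weight bounds `∫ Φ(p(t),t) dt` by a multiple of the number of pieces. -/
lemma integral_le_nat_mul_of_unit_weight {T K : ℝ} {Φ : P → ℝ → ℝ}
    (hΦ : ∀ y, Continuous (Φ y)) (hΦ0 : ∀ y t, 0 ≤ Φ y t) {w : P → ℝ}
    (p₀ : P) (hp₀ : w p₀ = 0)
    (hK : ∀ p : SimpleFunc ℝ P, ∫ t in (0 : ℝ)..T, w (p t) ≤ 1 → ∫ t in (0 : ℝ)..T, Φ (p t) t ≤ K)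
    (p : SimpleFunc ℝ P) (k : ℕ) {s : ℝ} (hs : s ∈ Icc 0 T)
    (hks : ∫ t in (0 : ℝ)..s, w (p t) ≤ k + 1) :
    ∫ t in (0 : ℝ)..s, Φ (p t) t ≤ (k + 1) * K := by
  classical
  have hwi (p : SimpleFunc ℝ P) (a b : ℝ) : IntervalIntegrable (fun t => w (p t)) volume a b :=
    intervalIntegrable_comp_simpleFunc p (Φ := fun y _ => w y) (fun _ => continuous_const) a b
  have hΦi (p : SimpleFunc ℝ P) (a b : ℝ) := intervalIntegrable_comp_simpleFunc p hΦ a b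
  have hstep {a b : ℝ} (ha : 0 ≤ a) (hab : a ≤ b) (hb : b ≤ T)
      (h : ∫ t in a..b, w (p t) ≤ 1) : ∫ t in a..b, Φ (p t) t ≤ K := by
    set p' : SimpleFunc ℝ P :=
      SimpleFunc.piecewise (Ioc a b) measurableSet_Ioc p (SimpleFunc.const ℝ p₀) with hp'
    have hin : ∀ t ∈ Ioc a b, p' t = p t := fun t ht => by simp [hp', ht]
    have hout : ∀ t ∉ Ioc a b, p' t = p₀ := fun t ht => by
      rw [hp', SimpleFunc.piecewise_apply, if_neg ht]; rfl
    have hw' : ∫ t in (0 : ℝ)..T, w (p' t) = ∫ t in a..b, w (p t) := by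
      have hind : (fun t => w (p' t)) = (Ioc a b).indicator fun t => w (p t) := by
        ext t
        by_cases ht : t ∈ Ioc a b
        · rw [indicator_of_mem ht, hin t ht]
        · rw [indicator_of_notMem ht, hout t ht, hp₀]
      rw [hind, intervalIntegral.integral_of_le (ha.trans (hab.trans hb)),
        intervalIntegral.integral_of_le hab, setIntegral_indicator measurableSet_Ioc,
        inter_eq_right.2 (Ioc_subset_Ioc ha hb)]
    have h1 := hK p' (hw'.trans_le h)
    calc ∫ t in a..b, Φ (p t) t = ∫ t in a..b, Φ (p' t) t := by
          rw [intervalIntegral.integral_of_le hab, intervalIntegral.integral_of_le hab]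
          exact setIntegral_congr_fun measurableSet_Ioc fun t ht => by simp only [hin t ht]
      _ ≤ ∫ t in (0 : ℝ)..T, Φ (p' t) t :=
          intervalIntegral.integral_mono_interval ha hab hb
            (Eventually.of_forall fun t => hΦ0 _ _) (hΦi p' 0 T)
      _ ≤ K := h1
  induction k generalizing s with
  | zero => simpa using hstep le_rfl hs.1 hs.2 (by simpa using hks)
  | succ k ih =>
    by_cases hle : ∫ t in (0 : ℝ)..s, w (p t) ≤ k + 1
    · have hK0 : 0 ≤ K := by
        refine le_trans ?_ (hK (SimpleFunc.const ℝ p₀) (by simp [hp₀]))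
        exact intervalIntegral.integral_nonneg (hs.1.trans hs.2) fun t _ => hΦ0 _ _
      have := ih hs hle
      push_cast
      linarith
    · have hcont : ContinuousOn (fun x => ∫ t in (0 : ℝ)..x, w (p t)) (Icc 0 s) := by
        have := intervalIntegral.continuousOn_primitive_interval (μ := volume) (a := 0) (b := s)
          (f := fun t => w (p t)) ?_
        · rwa [uIcc_of_le hs.1] at this
        · rw [uIcc_of_le hs.1]
          exact (intervalIntegrable_iff_integrableOn_Icc_of_le hs.1).1 (hwi p 0 s)
      obtain ⟨c, hc, hcw⟩ := intermediate_value_Icc hs.1 hcont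
        (show (k : ℝ) + 1 ∈ Icc _ _ from ⟨by simp; positivity, (not_le.1 hle).le⟩)
      have hw2 := intervalIntegral.integral_add_adjacent_intervals (hwi p 0 c) (hwi p c s)
      have hΦ2 := intervalIntegral.integral_add_adjacent_intervals (hΦi p 0 c) (hΦi p c s)
      have h1 := ih ⟨hc.1, hc.2.trans hs.2⟩ hcw.le
      have h2 := hstep hc.1 hc.2 hs.2 (by push_cast at hks; simp only at hcw; linarith)
      push_cast
      linarith

lemma exists_simpleFunc_seq_maximizing (e : ℕ → P) (p₀ : P) {g : P → ℝ → ℝ}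
    (hg : ∀ y, Measurable (g y)) :
    ∃ s : ℕ → SimpleFunc ℝ P, (∀ t, s 0 t = p₀) ∧ ∀ n t,
      g (s n t) t ≤ g (s (n + 1) t) t ∧ g (e n) t ≤ g (s (n + 1) t) t := by
  classical
  have hmeas (p : SimpleFunc ℝ P) (n : ℕ) : MeasurableSet {t | g (p t) t < g (e n) t} :=
    measurableSet_lt (SimpleFunc.measurable_bind p g hg) (hg _)
  let s : ℕ → SimpleFunc ℝ P := fun n => Nat.rec (SimpleFunc.const ℝ p₀)
    (fun n p => SimpleFunc.piecewise _ (hmeas p n) (SimpleFunc.const ℝ (e n)) p) n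
  refine ⟨s, fun t => rfl, fun n t => ?_⟩
  have hs : s (n + 1) t = if g (s n t) t < g (e n) t then e n else s n t := rfl
  rw [hs]
  split_ifs with h
  · exact ⟨h.le, le_rfl⟩
  · exact ⟨le_rfl, not_lt.1 h⟩

/-- An integral bound over simple functions of unit weight yields a pointwise growth bound. -/
lemma exists_integrable_growth_bound [TopologicalSpace P] [TopologicalSpace.SeparableSpace P]
    {T K : ℝ} (hT : 0 < T) {Φ : P → ℝ → ℝ}
    (hΦ : ∀ y, Continuous (Φ y)) (hΦc : ∀ t, Continuous fun y => Φ y t)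
    (hΦ0 : ∀ y t, 0 ≤ Φ y t) {w : P → ℝ} (hw : Continuous w) (hw0 : ∀ y, 0 ≤ w y)
    (p₀ : P) (hp₀ : w p₀ = 0)
    (hK : ∀ p : SimpleFunc ℝ P, ∫ t in Ioc 0 T, w (p t) ≤ 1 → ∫ t in Ioc 0 T, Φ (p t) t ≤ K) :
    ∃ ω : ℝ → ℝ, Integrable ω (muT T) ∧ (∀ t, 0 ≤ ω t) ∧
      ∀ᵐ t ∂(muT T), ∀ y, Φ y t ≤ K * w y + ω t := by
  have : Nonempty P := ⟨p₀⟩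
  have hK0 : 0 ≤ K := by
    refine le_trans ?_ (hK (SimpleFunc.const ℝ p₀) (by simp [hp₀]))
    exact integral_nonneg fun t => hΦ0 _ _
  set g : P → ℝ → ℝ := fun y t => Φ y t - K * w y with hgdef
  have hgc (y : P) : Continuous (g y) := (hΦ y).sub continuous_const
  obtain ⟨s, hs0, hs⟩ := exists_simpleFunc_seq_maximizing (TopologicalSpace.denseSeq P) p₀
    (g := g) fun y => (hgc y).measurable
  have hmono (t : ℝ) : Monotone fun n => g (s n t) t := monotone_nat_of_le_succ fun n => (hs n t).1
  have hg0 (n : ℕ) (t : ℝ) : 0 ≤ g (s n t) t := by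
    refine le_trans ?_ (hmono t n.zero_le)
    simp [hgdef, hs0, hp₀, hΦ0]
  have hgi (n : ℕ) : Integrable (fun t => g (s n t) t) (muT T) :=
    (intervalIntegrable_iff_integrableOn_Ioc_of_le hT.le).1
      (intervalIntegrable_comp_simpleFunc (s n) hgc 0 T)
  have hgK (n : ℕ) : ∫ t, g (s n t) t ∂(muT T) ≤ K := by
    have hwi : Integrable (fun t => w (s n t)) (muT T) :=
      (intervalIntegrable_iff_integrableOn_Ioc_of_le hT.le).1
        (intervalIntegrable_comp_simpleFunc (s n) (Φ := fun y _ => w y)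
          (fun _ => continuous_const) 0 T)
    have hΦi : Integrable (fun t => Φ (s n t) t) (muT T) :=
      (intervalIntegrable_iff_integrableOn_Ioc_of_le hT.le).1
        (intervalIntegrable_comp_simpleFunc (s n) hΦ 0 T)
    have hsplit : ∫ t, g (s n t) t ∂(muT T)
        = ∫ t, Φ (s n t) t ∂(muT T) - K * ∫ t, w (s n t) ∂(muT T) := by
      rw [← integral_const_mul, ← integral_sub hΦi (hwi.const_mul K)]
    have hM0 : 0 ≤ ∫ t, w (s n t) ∂(muT T) := integral_nonneg fun t => hw0 _
    have hΦM := integral_le_nat_mul_of_unit_weight hΦ hΦ0 p₀ hp₀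
      (by simpa only [intervalIntegral.integral_of_le hT.le] using hK) (s n)
      ⌊∫ t, w (s n t) ∂(muT T)⌋₊ (right_mem_Icc.2 hT.le)
      (by rw [intervalIntegral.integral_of_le hT.le]; exact (Nat.lt_floor_add_one _).le)
    rw [intervalIntegral.integral_of_le hT.le] at hΦM
    have hfl := mul_le_mul_of_nonneg_right (Nat.floor_le hM0) hK0
    rw [hsplit]
    change ∫ t, Φ (s n t) t ∂(muT T) ≤ _ at hΦM
    linarith
  have hlint : ∫⁻ t, ⨆ n, ENNReal.ofReal (g (s n t) t) ∂(muT T) ≤ ENNReal.ofReal K := by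
    rw [lintegral_iSup]
    · refine iSup_le fun n => ?_
      rw [← ofReal_integral_eq_lintegral_ofReal (hgi n) (Eventually.of_forall (hg0 n))]
      exact ENNReal.ofReal_le_ofReal (hgK n)
    · exact fun n =>
        (SimpleFunc.measurable_bind (s n) g fun y => (hgc y).measurable).ennreal_ofReal
    · exact fun i j hij t => ENNReal.ofReal_le_ofReal (hmono t hij)
  have hmeas : Measurable fun t => ⨆ n, ENNReal.ofReal (g (s n t) t) :=
    Measurable.iSup fun n =>
      (SimpleFunc.measurable_bind (s n) g fun y => (hgc y).measurable).ennreal_ofReal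
  have hne := (hlint.trans_lt ENNReal.ofReal_lt_top).ne
  refine ⟨fun t => (⨆ n, ENNReal.ofReal (g (s n t) t)).toReal,
    integrable_toReal_of_lintegral_ne_top hmeas.aemeasurable hne,
    fun t => ENNReal.toReal_nonneg, ?_⟩
  filter_upwards [ae_lt_top hmeas hne] with t ht
  refine isClosed_property (TopologicalSpace.denseRange_denseSeq P)
    (isClosed_le (hΦc t) ((continuous_const.mul hw).add continuous_const)) fun n => ?_
  have h1 : g (s (n + 1) t) t ≤ (⨆ n, ENNReal.ofReal (g (s n t) t)).toReal := by
    rw [← ENNReal.ofReal_le_iff_le_toReal ht.ne]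
    exact le_iSup (fun n => ENNReal.ofReal (g (s n t) t)) (n + 1)
  have h2 := (hs n t).2.trans h1
  simp only [hgdef] at h2 ⊢
  linarith

end Krasnoselskii

/-! ### `L^p` norms on `(0, T]` -/

instance isFiniteMeasure_muT (T : ℝ) : IsFiniteMeasure (muT T) :=
  ⟨by simp [muT]⟩

lemma ae_muT_mem_Icc (T : ℝ) : ∀ᵐ t ∂(muT T), t ∈ Icc 0 T := by
  filter_upwards [ae_restrict_mem (μ := volume) measurableSet_Ioc] with t ht
  exact Ioc_subset_Icc_self ht

section LpNorm

variable {E : Type*} [NormedAddCommGroup E]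
  {α : Type*} [MeasurableSpace α] {μ : Measure α}

lemma toReal_eLpNorm_add_smul_le [NormedSpace ℝ E] {p : ℝ≥0∞} (hp : 1 ≤ p) {x h : α → E} (hx : MemLp x p μ)
    (hh : MemLp h p μ) (ε : ℝ) :
    (eLpNorm (fun t => x t + ε • h t) p μ).toReal
      ≤ (eLpNorm x p μ).toReal + |ε| * (eLpNorm h p μ).toReal := by
  have h1 : eLpNorm (x + ε • h) p μ ≤ eLpNorm x p μ + eLpNorm (ε • h) p μ :=
    eLpNorm_add_le hx.1 (hh.1.const_smul ε) hp
  rw [eLpNorm_const_smul] at h1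
  have h2 := ENNReal.toReal_mono
    (ENNReal.add_ne_top.2 ⟨hx.2.ne, ENNReal.mul_ne_top enorm_ne_top hh.2.ne⟩) h1
  rwa [ENNReal.toReal_add hx.2.ne (ENNReal.mul_ne_top enorm_ne_top hh.2.ne), ENNReal.toReal_mul,
    toReal_enorm, Real.norm_eq_abs] at h2

lemma toReal_eLpNorm_add_smul_sub_self [NormedSpace ℝ E] (p : ℝ≥0∞) (x h : α → E) (ε : ℝ) :
    (eLpNorm (fun t => x t + ε • h t - x t) p μ).toReal = |ε| * (eLpNorm h p μ).toReal := by
  have : (fun t => x t + ε • h t - x t) = ε • h := by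
    ext t
    simp
  rw [this, eLpNorm_const_smul, ENNReal.toReal_mul, toReal_enorm, Real.norm_eq_abs]

lemma toReal_eLpNorm_top_le {x : α → E} {B : ℝ} (hB : 0 ≤ B) (hx : ∀ t, ‖x t‖ ≤ B) :
    (eLpNorm x ⊤ μ).toReal ≤ B := by
  have h := eLpNorm_le_of_ae_bound (p := ⊤) (μ := μ) (Eventually.of_forall hx)
  simp only [ENNReal.toReal_top, inv_zero, ENNReal.rpow_zero, one_mul] at h
  exact ENNReal.toReal_le_of_le_ofReal hB h

lemma ae_norm_le_toReal_eLpNorm_top {x : α → E} (hx : MemLp x ⊤ μ) :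
    ∀ᵐ t ∂μ, ‖x t‖ ≤ (eLpNorm x ⊤ μ).toReal := by
  filter_upwards [ae_le_eLpNormEssSup (f := x) (μ := μ)] with t ht
  rw [← toReal_enorm, eLpNorm_exponent_top]
  refine ENNReal.toReal_mono ?_ ht
  simpa using hx.2.ne

lemma toReal_eLpNorm_ofReal {q : ℝ} (hq : 0 < q) {u : α → E}
    (hu : MemLp u (ENNReal.ofReal q) μ) :
    (eLpNorm u (ENNReal.ofReal q) μ).toReal = (∫ t, ‖u t‖ ^ q ∂μ) ^ q⁻¹ := by
  rw [MemLp.eLpNorm_eq_integral_rpow_norm (by simpa using hq) ENNReal.ofReal_ne_top hu,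
    ENNReal.toReal_ofReal hq.le, ENNReal.toReal_ofReal]
  exact Real.rpow_nonneg (integral_nonneg fun t => by positivity) _

lemma integral_norm_rpow_eq {q : ℝ} (hq : 0 < q) {u : α → E}
    (hu : MemLp u (ENNReal.ofReal q) μ) :
    ∫ t, ‖u t‖ ^ q ∂μ = (eLpNorm u (ENNReal.ofReal q) μ).toReal ^ q := by
  rw [toReal_eLpNorm_ofReal hq hu, ← Real.rpow_mul (integral_nonneg fun t => by positivity),
    inv_mul_cancel₀ hq.ne', Real.rpow_one]

lemma integrable_norm_rpow_ofReal {q : ℝ} (hq : 0 < q) {u : α → E}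
    (hu : MemLp u (ENNReal.ofReal q) μ) : Integrable (fun t => ‖u t‖ ^ q) μ := by
  have := hu.integrable_norm_rpow (by simpa using hq) ENNReal.ofReal_ne_top
  rwa [ENNReal.toReal_ofReal hq.le] at this

lemma conjExponent_eq {q : ℝ} (hq : 1 < q) {q' : ℝ≥0∞} (hq' : (ENNReal.ofReal q)⁻¹ + q'⁻¹ = 1) :
    q' = ENNReal.ofReal (q / (q - 1)) := by
  have h0 : 0 < q := by linarith
  have : q'⁻¹ = ENNReal.ofReal (1 - q⁻¹) := by
    rw [ENNReal.ofReal_sub _ (by positivity), ENNReal.ofReal_inv_of_pos h0, ENNReal.ofReal_one]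
    refine ENNReal.eq_sub_of_add_eq ?_ (by rwa [add_comm])
    simpa using h0
  rw [← inv_inv q', this, ← ENNReal.ofReal_inv_of_pos (by
    have := inv_lt_one_of_one_lt₀ hq; linarith)]
  congr 1
  have : q - 1 ≠ 0 := by linarith
  field_simp

lemma conjExponent_one {q' : ℝ≥0∞} (hq' : (ENNReal.ofReal 1)⁻¹ + q'⁻¹ = 1) : q' = ⊤ := by
  simpa using hq'

lemma one_le_conjExponent {p q' : ℝ≥0∞} (hq' : p⁻¹ + q'⁻¹ = 1) : 1 ≤ q' := by
  rw [← ENNReal.inv_le_one, ← hq']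
  exact le_add_self

lemma memLp_norm_rpow_sub_one [IsFiniteMeasure μ] {q : ℝ} (hq : 1 ≤ q) {q' : ℝ≥0∞}
    (hq' : (ENNReal.ofReal q)⁻¹ + q'⁻¹ = 1) {u : α → E} (hu : MemLp u (ENNReal.ofReal q) μ) :
    MemLp (fun t => ‖u t‖ ^ (q - 1)) q' μ ∧
      (eLpNorm (fun t => ‖u t‖ ^ (q - 1)) q' μ).toReal
        ≤ (eLpNorm u (ENNReal.ofReal q) μ).toReal ^ (q - 1) := by
  rcases hq.eq_or_lt with rfl | hq1
  · obtain rfl := conjExponent_one hq'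
    simp only [sub_self, Real.rpow_zero]
    exact ⟨memLp_const _, toReal_eLpNorm_top_le zero_le_one fun _ => by simp⟩
  · have hq0 : 0 < q - 1 := by linarith
    have hmul : q' * ENNReal.ofReal (q - 1) = ENNReal.ofReal q := by
      rw [conjExponent_eq hq1 hq', ← ENNReal.ofReal_mul (by positivity)]
      congr 1
      field_simp
    have heq := eLpNorm_norm_rpow (p := q') (μ := μ) u hq0
    rw [hmul] at heq
    refine ⟨⟨?_, ?_⟩, ?_⟩
    · exact (hu.1.norm.aemeasurable.pow_const _).aestronglyMeasurable
    · rw [heq]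
      exact ENNReal.rpow_lt_top_of_nonneg hq0.le hu.2.ne
    · rw [heq, ENNReal.toReal_rpow]

lemma integral_mul_norm_le {p q : ℝ≥0∞} (hpq : q⁻¹ + p⁻¹ = 1) {G : α → ℝ} {v : α → E}
    (hG : MemLp G p μ) (hv : MemLp v q μ) :
    Integrable (fun t => G t * ‖v t‖) μ ∧
      ∫ t, G t * ‖v t‖ ∂μ ≤ (eLpNorm G p μ).toReal * (eLpNorm v q μ).toReal := by
  have : p.HolderTriple q 1 := ⟨by rw [add_comm, hpq, inv_one]⟩
  have hint : Integrable (fun t => G t * ‖v t‖) μ := hG.integrable_mul hv.norm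
  refine ⟨hint, (le_abs_self _).trans ?_⟩
  have h1 := eLpNorm_smul_le_mul_eLpNorm (p := p) (q := q) (r := 1) hv.1.norm hG.1
  rw [eLpNorm_norm] at h1
  have h2 := ENNReal.toReal_mono (ENNReal.mul_ne_top hG.2.ne hv.2.ne) h1
  rw [ENNReal.toReal_mul] at h2
  refine (abs_integral_le_integral_abs).trans (le_trans (le_of_eq ?_) h2)
  rw [eLpNorm_one_eq_lintegral_enorm]
  exact integral_norm_eq_lintegral_enorm hint.1

end LpNorm

/-! ### Gradient bounds along segments and differentiation under the integral -/

section Gradient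

lemma abs_sub_le_of_gradient_le {E : Type*} [NormedAddCommGroup E] [InnerProductSpace ℝ E]
    [CompleteSpace E] {f : E → ℝ} {f' : E → E}
    (hf : ∀ a, HasGradientAt f (f' a) a) {r C : ℝ} (hC : ∀ a, ‖a‖ ≤ r → ‖f' a‖ ≤ C) {a b : E}
    (ha : ‖a‖ ≤ r) (hb : ‖b‖ ≤ r) : |f a - f b| ≤ C * ‖a - b‖ := by
  refine Convex.norm_image_sub_le_of_norm_hasFDerivWithin_le (s := Metric.closedBall 0 r)
    (f' := fun a => InnerProductSpace.toDual ℝ E (f' a))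
    (fun x _ => (hf x).hasFDerivAt.hasFDerivWithinAt) (fun x hx => ?_) (convex_closedBall 0 r)
    (by simpa using hb) (by simpa using ha)
  rw [LinearIsometryEquiv.norm_map]
  exact hC x (by simpa using hx)

variable {E F : Type*} [NormedAddCommGroup E] [InnerProductSpace ℝ E] [FiniteDimensional ℝ E]
  [NormedAddCommGroup F] [InnerProductSpace ℝ F] [FiniteDimensional ℝ F]

lemma exists_norm_le_of_continuous {G : Type*} [NormedAddCommGroup G] {g : E → F → ℝ → G}
    (hg : Continuous fun z : E × F × ℝ => g z.1 z.2.1 z.2.2) (A B T : ℝ) :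
    ∃ M : ℝ, 0 ≤ M ∧ ∀ a b t, ‖a‖ ≤ A → ‖b‖ ≤ B → t ∈ Icc 0 T → ‖g a b t‖ ≤ M := by
  have : ProperSpace E := FiniteDimensional.proper ℝ E
  have : ProperSpace F := FiniteDimensional.proper ℝ F
  obtain ⟨M, hM⟩ := ((isCompact_closedBall (0 : E) A).prod
    ((isCompact_closedBall (0 : F) B).prod (isCompact_Icc (a := (0 : ℝ)) (b := T)))
    ).exists_bound_of_continuousOn hg.continuousOn
  refine ⟨max M 0, le_max_right _ _, fun a b t ha hb ht => ?_⟩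
  exact (hM (a, b, t) ⟨by simpa using ha, by simpa using hb, ht⟩).trans (le_max_left _ _)

lemma hasDerivAt_integral_add_smul [MeasurableSpace E] [BorelSpace E] [MeasurableSpace F]
    [BorelSpace F] {f : E → F → ℝ → ℝ} {f' : E → F → ℝ → E}
    (hf : Continuous fun z : E × F × ℝ => f z.1 z.2.1 z.2.2)
    (hf' : Continuous fun z : E × F × ℝ => f' z.1 z.2.1 z.2.2)
    (hgrad : ∀ a b t, HasGradientAt (fun a' => f a' b t) (f' a b t) a)
    {T B : ℝ} {x h : ℝ → E} {u : ℝ → F} (hx : Measurable x) (hh : Measurable h)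
    (hu : Measurable u) (hxB : ∀ t, ‖x t‖ ≤ B) (hhB : ∀ t ∈ Icc 0 T, ‖h t‖ ≤ B)
    (huB : ∀ t, ‖u t‖ ≤ B) :
    HasDerivAt (fun ε : ℝ => ∫ t, f (x t + ε • h t) (u t) t ∂(muT T))
      (∫ t, inner ℝ (f' (x t) (u t) t) (h t) ∂(muT T)) 0 := by
  have hB : 0 ≤ B := (norm_nonneg _).trans (hxB 0)
  have hmeas (ε : ℝ) : Measurable fun t => (x t + ε • h t, u t, t) :=
    (hx.add (hh.const_smul ε)).prodMk (hu.prodMk measurable_id)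
  have hmem := ae_muT_mem_Icc T
  obtain ⟨M₀, -, hM₀⟩ := exists_norm_le_of_continuous hf B B T
  obtain ⟨M, hM0, hM⟩ := exists_norm_le_of_continuous hf' (B + B) B T
  have key := hasDerivAt_integral_of_dominated_loc_of_deriv_le (μ := muT T) (x₀ := (0 : ℝ))
    (s := Metric.ball 0 1) (F := fun (ε : ℝ) t => f (x t + ε • h t) (u t) t)
    (F' := fun (ε : ℝ) t => inner ℝ (f' (x t + ε • h t) (u t) t) (h t))
    (bound := fun _ => M * B) (Metric.ball_mem_nhds _ one_pos)
    (Eventually.of_forall fun ε => (hf.measurable.comp (hmeas ε)).aestronglyMeasurable)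
    ?_ ?_ ?_ (integrable_const _) ?_
  · simpa using key.2
  · refine Integrable.of_bound (hf.measurable.comp (hmeas 0)).aestronglyMeasurable M₀ ?_
    filter_upwards [hmem] with t ht
    simpa using hM₀ (x t) (u t) t (hxB t) (huB t) ht
  · exact ((hf'.measurable.comp (hmeas 0)).inner hh).aestronglyMeasurable
  · filter_upwards [hmem] with t ht ε hε
    refine (norm_inner_le_norm _ _).trans ?_
    have hε1 : |ε| ≤ 1 := by simpa using (mem_ball_zero_iff.1 hε).le
    refine mul_le_mul (hM _ _ _ ?_ (huB t) ht) (hhB t ht) (norm_nonneg _) hM0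
    refine (norm_add_le _ _).trans (add_le_add (hxB t) ?_)
    rw [norm_smul]
    exact (mul_le_of_le_one_left (norm_nonneg _) hε1).trans (hhB t ht)
  · refine Eventually.of_forall fun t ε _ => ?_
    have hline : HasDerivAt (fun ε : ℝ => x t + ε • h t) (h t) ε := by
      simpa using ((hasDerivAt_id ε).smul_const (h t)).const_add (x t)
    have := (hgrad (x t + ε • h t) (u t) t).hasFDerivAt.comp_hasDerivAt ε hline
    simpa [Function.comp_def] using this

end Gradient

/-! ### The two properties of the integrand -/

/-- `L` is a Lipschitz constant of `(x, u) ↦ ∫₀ᵀ θ(x(t), u(t), t) dt` on the ball of radius `r`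
of `L^∞ × L^q`. -/
def IsLipschitzConstOnBall {d m : ℕ} (T q : ℝ) (θ : Vec d → Vec m → ℝ → ℝ) (r L : ℝ) : Prop :=
  ∀ (x y : ℝ → Vec d) (u v : ℝ → Vec m),
    MemLp x ⊤ (muT T) → MemLp u (ENNReal.ofReal q) (muT T) →
    MemLp y ⊤ (muT T) → MemLp v (ENNReal.ofReal q) (muT T) →
    (eLpNorm x ⊤ (muT T)).toReal + (eLpNorm u (ENNReal.ofReal q) (muT T)).toReal ≤ r →
    (eLpNorm y ⊤ (muT T)).toReal + (eLpNorm v (ENNReal.ofReal q) (muT T)).toReal ≤ r →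
    |(∫ t in Set.Ioc (0:ℝ) T, θ (x t) (u t) t) - ∫ t in Set.Ioc (0:ℝ) T, θ (y t) (v t) t|
      ≤ L * ((eLpNorm (fun t => x t - y t) ⊤ (muT T)).toReal +
          (eLpNorm (fun t => u t - v t) (ENNReal.ofReal q) (muT T)).toReal)

/-- Lipschitz continuity of the integral functional on bounded subsets of `L^∞ × L^q`. -/
def LipschitzOnBounded {d m : ℕ} (T q : ℝ) (θ : Vec d → Vec m → ℝ → ℝ) : Prop :=
  ∀ r : ℝ, 0 < r → ∃ L : ℝ, 0 ≤ L ∧ IsLipschitzConstOnBall T q θ r L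

/-- The growth condition of order `(q, 1)`. -/
def GrowthOne {d m : ℕ} (T q : ℝ) (θ : Vec d → Vec m → ℝ → ℝ) : Prop :=
  ∀ R : ℝ, 0 < R → ∃ C : ℝ, 0 < C ∧ ∃ ω : ℝ → ℝ,
    Integrable ω (muT T) ∧ (∀ᵐ t ∂(muT T), 0 ≤ ω t) ∧
    ∀ᵐ t ∂(muT T), ∀ (a : Vec d) (b : Vec m), ‖a‖ ≤ R → |θ a b t| ≤ C * ‖b‖ ^ q + ω t

/-- The growth conditions of orders `(q, 1)` and `(q - 1, q')` on the two gradients. -/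
def GradientGrowth {d m : ℕ} (T q : ℝ) (q' : ℝ≥0∞)
    (θx : Vec d → Vec m → ℝ → Vec d) (θu : Vec d → Vec m → ℝ → Vec m) : Prop :=
  ∀ R : ℝ, 0 < R → ∃ C : ℝ, 0 < C ∧ ∃ ω η : ℝ → ℝ,
    Integrable ω (muT T) ∧ (∀ᵐ t ∂(muT T), 0 ≤ ω t) ∧
    MemLp η q' (muT T) ∧ (∀ᵐ t ∂(muT T), 0 ≤ η t) ∧
    ∀ᵐ t ∂(muT T), ∀ (a : Vec d) (b : Vec m), ‖a‖ ≤ R →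
      ‖θx a b t‖ ≤ C * ‖b‖ ^ q + ω t ∧ ‖θu a b t‖ ≤ C * ‖b‖ ^ (q - 1) + η t

section Main

variable {d m : ℕ} {T q : ℝ} {q' : ℝ≥0∞} {θ : Vec d → Vec m → ℝ → ℝ}
  {θx : Vec d → Vec m → ℝ → Vec d} {θu : Vec d → Vec m → ℝ → Vec m}

lemma GrowthOne.integrable (hq : 1 ≤ q)
    (hθc : Continuous fun z : Vec d × Vec m × ℝ => θ z.1 z.2.1 z.2.2) (hθ : GrowthOne T q θ)
    {x : ℝ → Vec d} {u : ℝ → Vec m} (hx : MemLp x ⊤ (muT T))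
    (hu : MemLp u (ENNReal.ofReal q) (muT T)) :
    Integrable (fun t => θ (x t) (u t) t) (muT T) := by
  obtain ⟨C, -, ω, hω, -, hb⟩ := hθ ((eLpNorm x ⊤ (muT T)).toReal + 1) (by positivity)
  refine (((integrable_norm_rpow_ofReal (by linarith) hu).const_mul C).add hω).mono'
    (hθc.comp_aestronglyMeasurable (hx.1.prodMk (hu.1.prodMk aestronglyMeasurable_id))) ?_
  filter_upwards [hb, ae_norm_le_toReal_eLpNorm_top hx] with t h1 h2
  exact h1 _ _ (by linarith)

lemma abs_sub_le_of_gradient_growth (hq : 1 ≤ q)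
    (hθx : ∀ a b t, HasGradientAt (fun a' => θ a' b t) (θx a b t) a)
    (hθu : ∀ a b t, HasGradientAt (fun b' => θ a b' t) (θu a b t) b)
    {R C t ω η : ℝ} (hC : 0 ≤ C)
    (hb : ∀ (a : Vec d) (b : Vec m), ‖a‖ ≤ R →
      ‖θx a b t‖ ≤ C * ‖b‖ ^ q + ω ∧ ‖θu a b t‖ ≤ C * ‖b‖ ^ (q - 1) + η)
    {x y : Vec d} {u v : Vec m} (hx : ‖x‖ ≤ R) (hy : ‖y‖ ≤ R) :
    |θ x u t - θ y v t| ≤ (C * ‖u‖ ^ q + ω) * ‖x - y‖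
      + (C * ‖u‖ ^ (q - 1) + C * ‖v‖ ^ (q - 1) + η) * ‖u - v‖ := by
  have h1 : |θ x u t - θ y u t| ≤ (C * ‖u‖ ^ q + ω) * ‖x - y‖ :=
    abs_sub_le_of_gradient_le (fun a => hθx a u t) (fun a ha => (hb a u ha).1) hx hy
  have h2 : |θ y u t - θ y v t|
      ≤ (C * ‖u‖ ^ (q - 1) + C * ‖v‖ ^ (q - 1) + η) * ‖u - v‖ := by
    refine abs_sub_le_of_gradient_le (fun b => hθu y b t) (r := max ‖u‖ ‖v‖) (fun b hbm => ?_)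
      (le_max_left _ _) (le_max_right _ _)
    refine (hb y b hy).2.trans ?_
    have hq0 : 0 ≤ q - 1 := by linarith
    have hu0 : 0 ≤ C * ‖u‖ ^ (q - 1) := by positivity
    have hv0 : 0 ≤ C * ‖v‖ ^ (q - 1) := by positivity
    rcases le_max_iff.1 hbm with h | h <;>
    · have := mul_le_mul_of_nonneg_left (Real.rpow_le_rpow (norm_nonneg b) h hq0) hC
      linarith
  calc |θ x u t - θ y v t| = |(θ x u t - θ y u t) + (θ y u t - θ y v t)| := by ring_nf
    _ ≤ _ := (abs_add_le _ _).trans (add_le_add h1 h2)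

lemma GradientGrowth.lipschitzOnBounded (hq : 1 ≤ q) (hq' : (ENNReal.ofReal q)⁻¹ + q'⁻¹ = 1)
    (hθc : Continuous fun z : Vec d × Vec m × ℝ => θ z.1 z.2.1 z.2.2)
    (hθx : ∀ a b t, HasGradientAt (fun a' => θ a' b t) (θx a b t) a)
    (hθu : ∀ a b t, HasGradientAt (fun b' => θ a b' t) (θu a b t) b)
    (hθ : GrowthOne T q θ) (hgrad : GradientGrowth T q q' θx θu) : LipschitzOnBounded T q θ := by
  intro r hr
  obtain ⟨C, hC, ω, η, hω, hω0, hη, -, hb⟩ := hgrad r hr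
  have hq0 : 0 < q := by linarith
  have hωI : 0 ≤ ∫ t, ω t ∂(muT T) := integral_nonneg_of_ae hω0
  refine ⟨(C * r ^ q + ∫ t, ω t ∂(muT T))
    + (C * r ^ (q - 1) + C * r ^ (q - 1) + (eLpNorm η q' (muT T)).toReal), by positivity, ?_⟩
  intro x y u v hx hu hy hv hxu hyv
  set D := (eLpNorm (fun t => x t - y t) ⊤ (muT T)).toReal
  set D' := (eLpNorm (fun t => u t - v t) (ENNReal.ofReal q) (muT T)).toReal
  have hD0 : 0 ≤ D := ENNReal.toReal_nonneg
  have hD'0 : 0 ≤ D' := ENNReal.toReal_nonneg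
  have hx0 : 0 ≤ (eLpNorm x ⊤ (muT T)).toReal := ENNReal.toReal_nonneg
  have hy0 : 0 ≤ (eLpNorm y ⊤ (muT T)).toReal := ENNReal.toReal_nonneg
  have hu0 : 0 ≤ (eLpNorm u (ENNReal.ofReal q) (muT T)).toReal := ENNReal.toReal_nonneg
  have hv0 : 0 ≤ (eLpNorm v (ENNReal.ofReal q) (muT T)).toReal := ENNReal.toReal_nonneg
  obtain ⟨huL, hun⟩ := memLp_norm_rpow_sub_one hq hq' hu
  obtain ⟨hvL, hvn⟩ := memLp_norm_rpow_sub_one hq hq' hv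
  obtain ⟨hi1, hI1⟩ := integral_mul_norm_le hq' huL (hu.sub hv)
  obtain ⟨hi2, hI2⟩ := integral_mul_norm_le hq' hvL (hu.sub hv)
  obtain ⟨hi3, hI3⟩ := integral_mul_norm_le hq' hη (hu.sub hv)
  have hui := integrable_norm_rpow_ofReal hq0 hu
  have huq := integral_norm_rpow_eq hq0 hu
  have hbound : ∀ᵐ t ∂(muT T), ‖θ (x t) (u t) t - θ (y t) (v t) t‖ ≤
      D * (C * ‖u t‖ ^ q + ω t) + (C * (‖u t‖ ^ (q - 1) * ‖(u - v) t‖)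
        + C * (‖v t‖ ^ (q - 1) * ‖(u - v) t‖) + η t * ‖(u - v) t‖) := by
    filter_upwards [hb, hω0, ae_norm_le_toReal_eLpNorm_top hx, ae_norm_le_toReal_eLpNorm_top hy,
      ae_norm_le_toReal_eLpNorm_top (hx.sub hy)] with t h1 h2 h3 h4 h5
    refine (abs_sub_le_of_gradient_growth hq hθx hθu hC.le h1 (h3.trans (by linarith))
      (h4.trans (by linarith))).trans ?_
    have h6 : (C * ‖u t‖ ^ q + ω t) * ‖x t - y t‖ ≤ (C * ‖u t‖ ^ q + ω t) * D :=
      mul_le_mul_of_nonneg_left h5 (by positivity)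
    simp only [Pi.sub_apply]
    linarith
  have hint1 : Integrable (fun t => D * (C * ‖u t‖ ^ q + ω t)) (muT T) :=
    ((hui.const_mul C).add hω).const_mul D
  have hint12 : Integrable (fun t => C * (‖u t‖ ^ (q - 1) * ‖(u - v) t‖)
      + C * (‖v t‖ ^ (q - 1) * ‖(u - v) t‖)) (muT T) := (hi1.const_mul C).add (hi2.const_mul C)
  have hint2 : Integrable (fun t => C * (‖u t‖ ^ (q - 1) * ‖(u - v) t‖)
      + C * (‖v t‖ ^ (q - 1) * ‖(u - v) t‖) + η t * ‖(u - v) t‖) (muT T) := hint12.add hi3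
  have hval : ∫ t, D * (C * ‖u t‖ ^ q + ω t) + (C * (‖u t‖ ^ (q - 1) * ‖(u - v) t‖)
        + C * (‖v t‖ ^ (q - 1) * ‖(u - v) t‖) + η t * ‖(u - v) t‖) ∂(muT T)
      = D * (C * ∫ t, ‖u t‖ ^ q ∂(muT T) + ∫ t, ω t ∂(muT T))
        + (C * ∫ t, ‖u t‖ ^ (q - 1) * ‖(u - v) t‖ ∂(muT T)
          + C * ∫ t, ‖v t‖ ^ (q - 1) * ‖(u - v) t‖ ∂(muT T)
          + ∫ t, η t * ‖(u - v) t‖ ∂(muT T)) := by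
    rw [integral_add hint1 hint2, integral_add hint12 hi3,
      integral_add (hi1.const_mul C) (hi2.const_mul C), integral_const_mul,
      integral_add (hui.const_mul C) hω, integral_const_mul, integral_const_mul,
      integral_const_mul]
  have hDs : (eLpNorm (u - v) (ENNReal.ofReal q) (muT T)).toReal = D' := rfl
  rw [hDs] at hI1 hI2 hI3
  have hq1 : 0 ≤ q - 1 := by linarith
  have hU : (eLpNorm u (ENNReal.ofReal q) (muT T)).toReal ^ (q - 1) ≤ r ^ (q - 1) :=
    Real.rpow_le_rpow hu0 (by linarith) hq1
  have hV : (eLpNorm v (ENNReal.ofReal q) (muT T)).toReal ^ (q - 1) ≤ r ^ (q - 1) :=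
    Real.rpow_le_rpow hv0 (by linarith) hq1
  have hUq : ∫ t, ‖u t‖ ^ q ∂(muT T) ≤ r ^ q :=
    huq.trans_le (Real.rpow_le_rpow hu0 (by linarith) hq0.le)
  have hJ1 := hI1.trans (mul_le_mul_of_nonneg_right (hun.trans hU) hD'0)
  have hJ2 := hI2.trans (mul_le_mul_of_nonneg_right (hvn.trans hV) hD'0)
  change |∫ t, θ (x t) (u t) t ∂(muT T) - ∫ t, θ (y t) (v t) t ∂(muT T)| ≤ _
  rw [← integral_sub (hθ.integrable hq hθc hx hu) (hθ.integrable hq hθc hy hv)]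
  refine (norm_integral_le_of_norm_le (hint1.add hint2) hbound).trans (hval.trans_le ?_)
  have hη0 : 0 ≤ (eLpNorm η q' (muT T)).toReal := ENNReal.toReal_nonneg
  have hA : 0 ≤ C * r ^ q + ∫ t, ω t ∂(muT T) := by positivity
  have hB : 0 ≤ C * r ^ (q - 1) + C * r ^ (q - 1) + (eLpNorm η q' (muT T)).toReal := by
    positivity
  calc _ ≤ D * (C * r ^ q + ∫ t, ω t ∂(muT T))
        + (C * (r ^ (q - 1) * D') + C * (r ^ (q - 1) * D')
          + (eLpNorm η q' (muT T)).toReal * D') := by gcongr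
    _ ≤ _ := by nlinarith [mul_nonneg hA hD'0, mul_nonneg hB hD0]

lemma memLp_muT_of_bound {E : Type*} [NormedAddCommGroup E] [MeasurableSpace E] [BorelSpace E]
    [SecondCountableTopology E] {h : ℝ → E} (hh : Measurable h) {B : ℝ}
    (hB : ∀ t ∈ Icc 0 T, ‖h t‖ ≤ B) (p : ℝ≥0∞) : MemLp h p (muT T) :=
  MemLp.of_bound hh.aestronglyMeasurable B ((ae_muT_mem_Icc T).mono hB)

lemma IsLipschitzConstOnBall.abs_integral_inner_left_le
    (hθc : Continuous fun z : Vec d × Vec m × ℝ => θ z.1 z.2.1 z.2.2)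
    (hθx : ∀ a b t, HasGradientAt (fun a' => θ a' b t) (θx a b t) a)
    (hθxc : Continuous fun z : Vec d × Vec m × ℝ => θx z.1 z.2.1 z.2.2)
    {r L : ℝ} (hL0 : 0 ≤ L) (hL : IsLipschitzConstOnBall T q θ r L) {B : ℝ}
    {x h : ℝ → Vec d} {u : ℝ → Vec m} (hx : Measurable x) (hh : Measurable h)
    (hu : Measurable u) (hxB : ∀ t, ‖x t‖ ≤ B) (hhB : ∀ t ∈ Icc 0 T, ‖h t‖ ≤ B)
    (huB : ∀ t, ‖u t‖ ≤ B)
    (hr : (eLpNorm x ⊤ (muT T)).toReal + (eLpNorm u (ENNReal.ofReal q) (muT T)).toReal < r) :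
    |∫ t, inner ℝ (θx (x t) (u t) t) (h t) ∂(muT T)| ≤ L * (eLpNorm h ⊤ (muT T)).toReal := by
  have hxL : MemLp x ⊤ (muT T) := memLp_muT_of_bound hx (fun t _ => hxB t) _
  have hhL : MemLp h ⊤ (muT T) := memLp_muT_of_bound hh hhB _
  have huL : MemLp u (ENNReal.ofReal q) (muT T) := memLp_muT_of_bound hu (fun t _ => huB t) _
  refine (hasDerivAt_integral_add_smul hθc hθxc hθx hx hh hu hxB hhB huB).le_of_lip'
    (by positivity) ?_
  have hcont : Continuous fun ε : ℝ => (eLpNorm x ⊤ (muT T)).toReal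
      + |ε| * (eLpNorm h ⊤ (muT T)).toReal
      + (eLpNorm u (ENNReal.ofReal q) (muT T)).toReal := by fun_prop
  have hev := (hcont.tendsto 0).eventually (gt_mem_nhds (show _ < r by simpa using hr))
  filter_upwards [hev] with ε hε
  have hadd := toReal_eLpNorm_add_smul_le le_top hxL hhL ε
  have h1 := hL (fun t => x t + ε • h t) x u u (hxL.add (hhL.const_smul ε)) huL hxL huL
    (by linarith) hr.le
  rw [toReal_eLpNorm_add_smul_sub_self] at h1
  simp only [sub_self, eLpNorm_zero', ENNReal.toReal_zero, add_zero] at h1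
  simp only [zero_smul, add_zero, sub_zero, Real.norm_eq_abs]
  exact h1.trans_eq (by ring)

lemma IsLipschitzConstOnBall.abs_integral_inner_right_le (hq : 1 ≤ q)
    (hθc : Continuous fun z : Vec d × Vec m × ℝ => θ z.1 z.2.1 z.2.2)
    (hθu : ∀ a b t, HasGradientAt (fun b' => θ a b' t) (θu a b t) b)
    (hθuc : Continuous fun z : Vec d × Vec m × ℝ => θu z.1 z.2.1 z.2.2)
    {r L : ℝ} (hL0 : 0 ≤ L) (hL : IsLipschitzConstOnBall T q θ r L) {B : ℝ}
    {x : ℝ → Vec d} {u h : ℝ → Vec m} (hx : Measurable x) (hh : Measurable h)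
    (hu : Measurable u) (hxB : ∀ t, ‖x t‖ ≤ B) (hhB : ∀ t ∈ Icc 0 T, ‖h t‖ ≤ B)
    (huB : ∀ t, ‖u t‖ ≤ B)
    (hr : (eLpNorm x ⊤ (muT T)).toReal + (eLpNorm u (ENNReal.ofReal q) (muT T)).toReal < r) :
    |∫ t, inner ℝ (θu (x t) (u t) t) (h t) ∂(muT T)|
      ≤ L * (eLpNorm h (ENNReal.ofReal q) (muT T)).toReal := by
  have hxL : MemLp x ⊤ (muT T) := memLp_muT_of_bound hx (fun t _ => hxB t) _
  have hhL : MemLp h (ENNReal.ofReal q) (muT T) := memLp_muT_of_bound hh hhB _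
  have huL : MemLp u (ENNReal.ofReal q) (muT T) := memLp_muT_of_bound hu (fun t _ => huB t) _
  have hswap : Continuous fun z : Vec m × Vec d × ℝ => (z.2.1, z.1, z.2.2) := by fun_prop
  refine (hasDerivAt_integral_add_smul (f := fun b a t => θ a b t) (f' := fun b a t => θu a b t)
    (hθc.comp hswap) (hθuc.comp hswap) (fun b a t => hθu a b t) hu hh hx huB hhB hxB).le_of_lip'
    (by positivity) ?_
  have hcont : Continuous fun ε : ℝ => (eLpNorm x ⊤ (muT T)).toReal
      + ((eLpNorm u (ENNReal.ofReal q) (muT T)).toReal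
      + |ε| * (eLpNorm h (ENNReal.ofReal q) (muT T)).toReal) := by fun_prop
  have hev := (hcont.tendsto 0).eventually (gt_mem_nhds (show _ < r by simpa using hr))
  filter_upwards [hev] with ε hε
  have hadd := toReal_eLpNorm_add_smul_le (by simpa using hq) huL hhL ε
  have h1 := hL x x (fun t => u t + ε • h t) u hxL (huL.add (hhL.const_smul ε)) hxL huL
    (by linarith) hr.le
  rw [toReal_eLpNorm_add_smul_sub_self] at h1
  simp only [sub_self, eLpNorm_zero', ENNReal.toReal_zero, zero_add] at h1
  simp only [zero_smul, add_zero, sub_zero, Real.norm_eq_abs]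
  exact h1.trans_eq (by ring)

lemma exists_bound_and_norm_lt_of_simpleFunc (hq : 1 ≤ q) {R : ℝ} (hR : 0 ≤ R)
    (p : SimpleFunc ℝ (Metric.closedBall (0 : Vec d) R × Vec m))
    (hp : ∫ t in Ioc 0 T, ‖(p t).2‖ ^ q ≤ 1) :
    Measurable (fun t => ((p t).1 : Vec d)) ∧ Measurable (fun t => (p t).2) ∧
    ∃ B : ℝ, (∀ t, ‖((p t).1 : Vec d)‖ ≤ B) ∧ (∀ t, ‖(p t).2‖ ≤ B) ∧
      (eLpNorm (fun t => ((p t).1 : Vec d)) ⊤ (muT T)).toReal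
        + (eLpNorm (fun t => (p t).2) (ENNReal.ofReal q) (muT T)).toReal < R + 2 := by
  have hum : Measurable fun t => (p t).2 := (p.map Prod.snd).measurable
  obtain ⟨B, hB⟩ := (p.map Prod.snd).exists_forall_norm_le
  have hxR (t : ℝ) : ‖((p t).1 : Vec d)‖ ≤ R := mem_closedBall_zero_iff.1 (p t).1.2
  refine ⟨measurable_subtype_coe.comp (p.map Prod.fst).measurable, hum, max B R,
    fun t => (hxR t).trans (le_max_right _ _), fun t => (hB t).trans (le_max_left _ _), ?_⟩
  have h1 := toReal_eLpNorm_top_le (μ := muT T) hR hxR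
  have h2 : (eLpNorm (fun t => (p t).2) (ENNReal.ofReal q) (muT T)).toReal ≤ 1 := by
    rw [toReal_eLpNorm_ofReal (by linarith) (memLp_muT_of_bound hum (fun t _ => hB t) _)]
    exact Real.rpow_le_one (integral_nonneg fun t => by positivity) hp (by positivity)
  linarith

/-! ### Necessity of the growth conditions -/

lemma IsLipschitzConstOnBall.exists_growth_left (hT : 0 < T) (hq : 1 ≤ q)
    (hθc : Continuous fun z : Vec d × Vec m × ℝ => θ z.1 z.2.1 z.2.2)
    (hθx : ∀ a b t, HasGradientAt (fun a' => θ a' b t) (θx a b t) a)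
    (hθxc : Continuous fun z : Vec d × Vec m × ℝ => θx z.1 z.2.1 z.2.2)
    {R L : ℝ} (hR : 0 < R) (hL0 : 0 ≤ L) (hL : IsLipschitzConstOnBall T q θ (R + 2) L) :
    ∃ ω : ℝ → ℝ, Integrable ω (muT T) ∧ (∀ t, 0 ≤ ω t) ∧
      ∀ᵐ t ∂(muT T), ∀ (a : Vec d) (b : Vec m), ‖a‖ ≤ R → ‖θx a b t‖ ≤ L * ‖b‖ ^ q + ω t := by
  have hK : ∀ p : SimpleFunc ℝ (Metric.closedBall (0 : Vec d) R × Vec m),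
      ∫ t in Ioc 0 T, ‖(p t).2‖ ^ q ≤ 1 → ∫ t in Ioc 0 T, ‖θx (p t).1 (p t).2 t‖ ≤ L := by
    intro p hp
    obtain ⟨hxm, hum, B, hxB, huB, hlt⟩ := exists_bound_and_norm_lt_of_simpleFunc hq hR.le p hp
    set g : ℝ → Vec d := fun t => θx (p t).1 (p t).2 t with hg
    have hgm : Measurable g := hθxc.measurable.comp (hxm.prodMk (hum.prodMk measurable_id))
    have hh1 (t : ℝ) : ‖‖g t‖⁻¹ • g t‖ ≤ 1 := by
      rw [norm_smul, norm_inv, norm_norm]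
      exact inv_mul_le_one
    have key := hL.abs_integral_inner_left_le (B := max B 1) hθc hθx hθxc hL0 hxm
      (h := fun t => ‖g t‖⁻¹ • g t) (hgm.norm.inv.smul hgm) hum
      (fun t => (hxB t).trans (le_max_left _ _)) (fun t _ => (hh1 t).trans (le_max_right _ _))
      (fun t => (huB t).trans (le_max_left _ _)) hlt
    have hinner (t : ℝ) : inner ℝ (g t) (‖g t‖⁻¹ • g t) = ‖g t‖ := by
      rw [real_inner_smul_right, real_inner_self_eq_norm_sq, sq, ← mul_assoc]
      rcases eq_or_ne ‖g t‖ 0 with h | h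
      · simp [h]
      · rw [inv_mul_cancel₀ h, one_mul]
    simp only [hg] at hinner key
    simp only [hinner] at key
    exact (le_abs_self _).trans (key.trans (mul_le_of_le_one_right hL0
      (toReal_eLpNorm_top_le zero_le_one hh1)))
  obtain ⟨ω, hω, hω0, hb⟩ := exists_integrable_growth_bound (K := L) hT
    (P := Metric.closedBall (0 : Vec d) R × Vec m) (Φ := fun z t => ‖θx z.1 z.2 t‖)
    (fun z => (hθxc.comp (by fun_prop : Continuous fun t : ℝ => ((z.1 : Vec d), z.2, t))).norm)
    (fun t => (hθxc.comp (by fun_prop : Continuous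
      fun z : Metric.closedBall (0 : Vec d) R × Vec m => ((z.1 : Vec d), z.2, t))).norm)
    (fun _ _ => norm_nonneg _) (w := fun z => ‖z.2‖ ^ q)
    (continuous_snd.norm.rpow_const fun _ => Or.inr (by linarith)) (fun _ => by positivity)
    (⟨0, by simpa using hR.le⟩, 0) (by simp [Real.zero_rpow (by linarith : q ≠ 0)]) hK
  refine ⟨ω, hω, hω0, hb.mono fun t ht a b ha => ?_⟩
  exact ht (⟨a, by simpa using ha⟩, b)

lemma le_rpow_of_le_mul_rpow {q S L : ℝ} (hq : 1 < q) (hS : 0 ≤ S) (hL : 0 ≤ L)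
    (h : S ≤ L * S ^ q⁻¹) : S ≤ L ^ (q / (q - 1)) := by
  rcases hS.eq_or_lt with rfl | hS
  · positivity
  have hq0 : 0 < q - 1 := by linarith
  have hle : S ^ ((q - 1) / q) ≤ L := by
    have : S = S ^ ((q - 1) / q) * S ^ q⁻¹ := by
      rw [← Real.rpow_add hS]
      have : (q - 1) / q + q⁻¹ = 1 := by
        field_simp
        ring
      rw [this, Real.rpow_one]
    exact le_of_mul_le_mul_right (this.symm.trans_le h) (by positivity)
  have h2 := Real.rpow_le_rpow (by positivity) hle (by positivity : 0 ≤ q / (q - 1))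
  rw [← Real.rpow_mul hS.le] at h2
  have : (q - 1) / q * (q / (q - 1)) = 1 := by field_simp
  rwa [this, Real.rpow_one] at h2

lemma IsLipschitzConstOnBall.exists_growth_right_of_one_lt (hT : 0 < T) (hq : 1 < q)
    (hq' : (ENNReal.ofReal q)⁻¹ + q'⁻¹ = 1)
    (hθc : Continuous fun z : Vec d × Vec m × ℝ => θ z.1 z.2.1 z.2.2)
    (hθu : ∀ a b t, HasGradientAt (fun b' => θ a b' t) (θu a b t) b)
    (hθuc : Continuous fun z : Vec d × Vec m × ℝ => θu z.1 z.2.1 z.2.2)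
    {R L : ℝ} (hR : 0 < R) (hL0 : 0 ≤ L) (hL : IsLipschitzConstOnBall T q θ (R + 2) L) :
    ∃ η : ℝ → ℝ, MemLp η q' (muT T) ∧ (∀ t, 0 ≤ η t) ∧
      ∀ᵐ t ∂(muT T), ∀ (a : Vec d) (b : Vec m), ‖a‖ ≤ R →
        ‖θu a b t‖ ≤ L * ‖b‖ ^ (q - 1) + η t := by
  have hq0 : 0 < q - 1 := by linarith
  set s : ℝ := q / (q - 1) with hs
  have hs1 : 1 < s := by rw [hs, lt_div_iff₀ hq0]; linarith
  have hs0 : 0 < s := by linarith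
  have hsq : (s - 1) * q = s := by rw [hs]; field_simp; ring
  have hqs : q * s⁻¹ = q - 1 := by rw [hs]; field_simp
  have hK : ∀ p : SimpleFunc ℝ (Metric.closedBall (0 : Vec d) R × Vec m),
      ∫ t in Ioc 0 T, ‖(p t).2‖ ^ q ≤ 1 → ∫ t in Ioc 0 T, ‖θu (p t).1 (p t).2 t‖ ^ s ≤ L ^ s := by
    intro p hp
    obtain ⟨hxm, hum, B, hxB, huB, hlt⟩ := exists_bound_and_norm_lt_of_simpleFunc hq.le hR.le p hp
    obtain ⟨M, hM0, hM⟩ := exists_norm_le_of_continuous hθuc B B T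
    set g : ℝ → Vec m := fun t => θu (p t).1 (p t).2 t with hg
    have hgm : Measurable g := hθuc.measurable.comp (hxm.prodMk (hum.prodMk measurable_id))
    have hh1 (t : ℝ) : ‖‖g t‖ ^ (s - 2) • g t‖ = ‖g t‖ ^ (s - 1) := by
      rw [norm_smul, Real.norm_of_nonneg (by positivity)]
      rcases (norm_nonneg (g t)).eq_or_lt with h | h
      · rw [← h, mul_zero, Real.zero_rpow (by linarith)]
      · nth_rewrite 2 [← Real.rpow_one ‖g t‖]
        rw [← Real.rpow_add h]
        ring_nf
    have hhM (t : ℝ) (ht : t ∈ Icc 0 T) : ‖‖g t‖ ^ (s - 2) • g t‖ ≤ max B (M ^ (s - 1)) := by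
      rw [hh1]
      exact (Real.rpow_le_rpow (norm_nonneg _) (hM _ _ t (hxB t) (huB t) ht)
        (by linarith)).trans (le_max_right _ _)
    have hhm : Measurable fun t => ‖g t‖ ^ (s - 2) • g t := (hgm.norm.pow_const _).smul hgm
    have key := hL.abs_integral_inner_right_le hq.le hθc hθu hθuc hL0 hxm
      hhm hum (fun t => (hxB t).trans (le_max_left _ _)) hhM
      (fun t => (huB t).trans (le_max_left _ _)) hlt
    have hinner (t : ℝ) : inner ℝ (g t) (‖g t‖ ^ (s - 2) • g t) = ‖g t‖ ^ s := by
      rw [real_inner_smul_right, real_inner_self_eq_norm_sq]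
      rcases (norm_nonneg (g t)).eq_or_lt with h | h
      · rw [← h, Real.zero_rpow hs0.ne']
        simp
      · rw [← Real.rpow_natCast, ← Real.rpow_add h]
        congr 1
        push_cast
        ring
    rw [toReal_eLpNorm_ofReal (by linarith) (memLp_muT_of_bound hhm hhM _)] at key
    simp only [hh1, ← Real.rpow_mul (norm_nonneg _), hsq] at key
    simp only [hg] at hinner key
    simp only [hinner] at key
    exact le_rpow_of_le_mul_rpow hq (integral_nonneg fun t => by positivity) hL0
      ((le_abs_self _).trans key)
  obtain ⟨ω, hω, hω0, hb⟩ := exists_integrable_growth_bound (K := L ^ s) hT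
    (P := Metric.closedBall (0 : Vec d) R × Vec m) (Φ := fun z t => ‖θu z.1 z.2 t‖ ^ s)
    (fun z => (hθuc.comp (by fun_prop : Continuous
      fun t : ℝ => ((z.1 : Vec d), z.2, t))).norm.rpow_const fun _ => Or.inr hs0.le)
    (fun t => (hθuc.comp (by fun_prop : Continuous
      fun z : Metric.closedBall (0 : Vec d) R × Vec m =>
        ((z.1 : Vec d), z.2, t))).norm.rpow_const fun _ => Or.inr hs0.le)
    (fun _ _ => by positivity) (w := fun z => ‖z.2‖ ^ q)
    (continuous_snd.norm.rpow_const fun _ => Or.inr (by linarith)) (fun _ => by positivity)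
    (⟨0, by simpa using hR.le⟩, 0) (by simp [Real.zero_rpow (by linarith : q ≠ 0)]) hK
  refine ⟨fun t => ω t ^ s⁻¹, ?_, fun t => Real.rpow_nonneg (hω0 t) _,
    hb.mono fun t ht a b ha => ?_⟩
  · rw [conjExponent_eq hq hq', ← hs]
    have heq := eLpNorm_norm_rpow (p := ENNReal.ofReal s) (μ := muT T) ω (inv_pos.2 hs0)
    rw [← ENNReal.ofReal_mul hs0.le, mul_inv_cancel₀ hs0.ne', ENNReal.ofReal_one] at heq
    simp only [Real.norm_of_nonneg (hω0 _)] at heq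
    refine ⟨(hω.1.aemeasurable.pow_const _).aestronglyMeasurable, ?_⟩
    rw [heq]
    exact ENNReal.rpow_lt_top_of_nonneg (by positivity) (memLp_one_iff_integrable.2 hω).2.ne
  · have h1 := ht (⟨a, by simpa using ha⟩, b)
    calc ‖θu a b t‖ = (‖θu a b t‖ ^ s) ^ s⁻¹ := by
          rw [← Real.rpow_mul (norm_nonneg _), mul_inv_cancel₀ hs0.ne', Real.rpow_one]
      _ ≤ (L ^ s * ‖b‖ ^ q + ω t) ^ s⁻¹ := Real.rpow_le_rpow (by positivity) h1 (by positivity)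
      _ ≤ (L ^ s * ‖b‖ ^ q) ^ s⁻¹ + ω t ^ s⁻¹ :=
          Real.rpow_add_le_add_rpow (by positivity) (hω0 t) (by positivity)
            (inv_le_one_of_one_le₀ hs1.le)
      _ = L * ‖b‖ ^ (q - 1) + ω t ^ s⁻¹ := by
          rw [Real.mul_rpow (by positivity) (by positivity), ← Real.rpow_mul hL0,
            ← Real.rpow_mul (norm_nonneg _), mul_inv_cancel₀ hs0.ne', Real.rpow_one, hqs]

lemma IsLipschitzConstOnBall.norm_gradient_right_le_of_one
    (hθc : Continuous fun z : Vec d × Vec m × ℝ => θ z.1 z.2.1 z.2.2)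
    (hθu : ∀ a b t, HasGradientAt (fun b' => θ a b' t) (θu a b t) b)
    (hθuc : Continuous fun z : Vec d × Vec m × ℝ => θu z.1 z.2.1 z.2.2)
    {R L : ℝ} (hR : 0 < R) (hL0 : 0 ≤ L) (hL : IsLipschitzConstOnBall T 1 θ (R + 2) L)
    {a : Vec d} (ha : ‖a‖ ≤ R) (b : Vec m) {t₀ : ℝ} (ht₀ : t₀ ∈ Ioo 0 T) :
    ‖θu a b t₀‖ ≤ L := by
  classical
  set g : ℝ → Vec m := fun t => θu a b t with hg
  have hgc : Continuous g := hθuc.comp (by fun_prop : Continuous fun t : ℝ => (a, b, t))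
  have hderiv := (hgc.norm.integral_hasStrictDerivAt t₀ t₀).hasDerivAt
  have hle := hderiv.le_of_lip' hL0 ?_
  · simpa using hle
  have hcont : Continuous fun s : ℝ => ‖b‖ * |s - t₀| := by fun_prop
  filter_upwards [Ioo_mem_nhds ht₀.1 ht₀.2, (hcont.tendsto t₀).eventually
    (gt_mem_nhds (show _ < (1 : ℝ) by simp))] with s hs hsb
  rw [intervalIntegral.integral_same, sub_zero, intervalIntegral.norm_intervalIntegral_eq]
  have hsub : uIoc t₀ s ⊆ Ioc 0 T := by
    intro t ht
    rcases mem_uIoc.1 ht with h | h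
    · exact ⟨ht₀.1.trans h.1, h.2.trans hs.2.le⟩
    · exact ⟨hs.1.trans h.1, h.2.trans ht₀.2.le⟩
  have hind {G : ℝ → ℝ} : ∫ t, (uIoc t₀ s).indicator G t ∂(muT T) = ∫ t in uIoc t₀ s, G t := by
    change ∫ t in Ioc 0 T, (uIoc t₀ s).indicator G t = _
    rw [setIntegral_indicator measurableSet_uIoc, inter_eq_right.2 hsub]
  have hvol : volume.real (uIoc t₀ s) = |s - t₀| := by
    rw [Measure.real, Real.volume_uIoc, ENNReal.toReal_ofReal (abs_nonneg _)]
  set p : SimpleFunc ℝ (Metric.closedBall (0 : Vec d) R × Vec m) :=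
    SimpleFunc.piecewise (uIoc t₀ s) measurableSet_uIoc
      (SimpleFunc.const ℝ (⟨a, by simpa using ha⟩, b))
      (SimpleFunc.const ℝ (⟨0, by simpa using hR.le⟩, 0)) with hp
  have hpin : ∀ t ∈ uIoc t₀ s, p t = (⟨a, by simpa using ha⟩, b) := fun t ht => by
    rw [hp, SimpleFunc.piecewise_apply, if_pos ht]; rfl
  have hpout : ∀ t ∉ uIoc t₀ s, p t = (⟨0, by simpa using hR.le⟩, 0) := fun t ht => by
    rw [hp, SimpleFunc.piecewise_apply, if_neg ht]; rfl
  have hpw : (fun t => ‖(p t).2‖ ^ (1 : ℝ)) = (uIoc t₀ s).indicator fun _ => ‖b‖ := by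
    ext t
    by_cases ht : t ∈ uIoc t₀ s
    · simp [hpin t ht, ht]
    · simp [hpout t ht, ht]
  have hp1 : ∫ t in Ioc 0 T, ‖(p t).2‖ ^ (1 : ℝ) ≤ 1 := by
    rw [hpw]
    refine (hind (G := fun _ => ‖b‖)).trans_le ?_
    rw [setIntegral_const, hvol, smul_eq_mul, mul_comm]
    exact hsb.le
  obtain ⟨hxm, hum, B, hxB, huB, hlt⟩ :=
    exists_bound_and_norm_lt_of_simpleFunc le_rfl hR.le p hp1
  set h : ℝ → Vec m := (uIoc t₀ s).indicator fun t => ‖g t‖⁻¹ • g t with hh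
  have hhm : Measurable h :=
    (hgc.measurable.norm.inv.smul hgc.measurable).indicator measurableSet_uIoc
  have hhn (t : ℝ) : ‖h t‖ ≤ (uIoc t₀ s).indicator (fun _ => (1 : ℝ)) t := by
    by_cases ht : t ∈ uIoc t₀ s
    · rw [hh, indicator_of_mem ht, indicator_of_mem ht, norm_smul, norm_inv, norm_norm]
      exact inv_mul_le_one
    · simp [hh, ht]
  have hh1 (t : ℝ) : ‖h t‖ ≤ 1 :=
    (hhn t).trans (indicator_le_self' (fun _ _ => zero_le_one) t)
  have key := hL.abs_integral_inner_right_le (B := max B 1) le_rfl hθc hθu hθuc hL0 hxm hhm hum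
    (fun t => (hxB t).trans (le_max_left _ _)) (fun t _ => (hh1 t).trans (le_max_right _ _))
    (fun t => (huB t).trans (le_max_left _ _)) hlt
  have hinner : (fun t => inner ℝ (θu (p t).1 (p t).2 t) (h t))
      = (uIoc t₀ s).indicator fun t => ‖g t‖ := by
    ext t
    by_cases ht : t ∈ uIoc t₀ s
    · rw [hh, indicator_of_mem ht, indicator_of_mem ht, hpin t ht, real_inner_smul_right]
      change ‖g t‖⁻¹ * inner ℝ (g t) (g t) = ‖g t‖
      rw [real_inner_self_eq_norm_sq, sq, ← mul_assoc]
      rcases eq_or_ne ‖g t‖ 0 with h0 | h0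
      · simp [h0]
      · rw [inv_mul_cancel₀ h0, one_mul]
    · simp [hh, ht]
  have hhL := memLp_muT_of_bound (T := T) hhm (fun t _ => hh1 t)
  rw [hinner, hind, toReal_eLpNorm_ofReal one_pos (hhL _)] at key
  simp only [Real.rpow_one, inv_one] at key
  refine key.trans (mul_le_mul_of_nonneg_left ?_ hL0)
  have hone : Integrable ((uIoc t₀ s).indicator fun _ => (1 : ℝ)) (muT T) :=
    (integrable_const _).indicator measurableSet_uIoc
  refine (integral_mono ((hhL 1).integrable le_rfl).norm hone hhn).trans ?_
  rw [hind, setIntegral_const, hvol, smul_eq_mul, mul_one, Real.norm_eq_abs]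

lemma IsLipschitzConstOnBall.exists_growth_right (hT : 0 < T) (hq : 1 ≤ q)
    (hq' : (ENNReal.ofReal q)⁻¹ + q'⁻¹ = 1)
    (hθc : Continuous fun z : Vec d × Vec m × ℝ => θ z.1 z.2.1 z.2.2)
    (hθu : ∀ a b t, HasGradientAt (fun b' => θ a b' t) (θu a b t) b)
    (hθuc : Continuous fun z : Vec d × Vec m × ℝ => θu z.1 z.2.1 z.2.2)
    {R L : ℝ} (hR : 0 < R) (hL0 : 0 ≤ L) (hL : IsLipschitzConstOnBall T q θ (R + 2) L) :
    ∃ η : ℝ → ℝ, MemLp η q' (muT T) ∧ (∀ t, 0 ≤ η t) ∧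
      ∀ᵐ t ∂(muT T), ∀ (a : Vec d) (b : Vec m), ‖a‖ ≤ R →
        ‖θu a b t‖ ≤ L * ‖b‖ ^ (q - 1) + η t := by
  rcases hq.eq_or_lt with rfl | hq
  · refine ⟨fun _ => 0, MemLp.zero', fun _ => le_rfl, ?_⟩
    have hmem : ∀ᵐ t ∂(muT T), t ∈ Ioo 0 T := by
      rw [muT, ← restrict_Ioo_eq_restrict_Ioc]
      exact ae_restrict_mem measurableSet_Ioo
    filter_upwards [hmem] with t ht a b ha
    simpa using hL.norm_gradient_right_le_of_one hθc hθu hθuc hR hL0 ha b ht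
  · exact hL.exists_growth_right_of_one_lt hT hq hq' hθc hθu hθuc hR hL0

lemma LipschitzOnBounded.gradientGrowth (hT : 0 < T) (hq : 1 ≤ q)
    (hq' : (ENNReal.ofReal q)⁻¹ + q'⁻¹ = 1)
    (hθc : Continuous fun z : Vec d × Vec m × ℝ => θ z.1 z.2.1 z.2.2)
    (hθx : ∀ a b t, HasGradientAt (fun a' => θ a' b t) (θx a b t) a)
    (hθu : ∀ a b t, HasGradientAt (fun b' => θ a b' t) (θu a b t) b)
    (hθxc : Continuous fun z : Vec d × Vec m × ℝ => θx z.1 z.2.1 z.2.2)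
    (hθuc : Continuous fun z : Vec d × Vec m × ℝ => θu z.1 z.2.1 z.2.2)
    (hLip : LipschitzOnBounded T q θ) : GradientGrowth T q q' θx θu := by
  intro R hR
  obtain ⟨L, hL0, hL⟩ := hLip (R + 2) (by linarith)
  obtain ⟨ω, hω, hω0, hωb⟩ := hL.exists_growth_left hT hq hθc hθx hθxc hR hL0
  obtain ⟨η, hη, hη0, hηb⟩ := hL.exists_growth_right hT hq hq' hθc hθu hθuc hR hL0
  refine ⟨L + 1, by linarith, ω, η, hω, Eventually.of_forall hω0, hη, Eventually.of_forall hη0, ?_⟩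
  filter_upwards [hωb, hηb] with t h1 h2 a b ha
  have hb1 : 0 ≤ ‖b‖ ^ q := by positivity
  have hb2 : 0 ≤ ‖b‖ ^ (q - 1) := by positivity
  exact ⟨(h1 a b ha).trans (by linarith), (h2 a b ha).trans (by linarith)⟩

/-! ### Extending the integrand in time -/

/-- Freeze the time variable outside `[0, T]`. -/
def clampTime {α β γ : Type*} (T : ℝ) (f : α → β → ℝ → γ) (a : α) (b : β) (t : ℝ) : γ :=
  f a b (max 0 (min T t))

lemma clampTime_of_mem {α β γ : Type*} (f : α → β → ℝ → γ) (a : α) (b : β)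
    {t : ℝ} (ht : t ∈ Icc 0 T) : clampTime T f a b t = f a b t := by
  rw [clampTime, min_eq_right ht.2, max_eq_right ht.1]

lemma clamp_mem_Icc (hT : 0 ≤ T) (t : ℝ) : max 0 (min T t) ∈ Icc 0 T :=
  ⟨le_max_left _ _, max_le hT (min_le_left _ _)⟩

lemma continuous_clampTime {γ : Type*} [TopologicalSpace γ] {f : Vec d → Vec m → ℝ → γ}
    (hT : 0 ≤ T)
    (hf : ContinuousOn (fun z : Vec d × Vec m × ℝ => f z.1 z.2.1 z.2.2)
      (Set.univ ×ˢ Set.univ ×ˢ Set.Icc 0 T)) :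
    Continuous fun z : Vec d × Vec m × ℝ => clampTime T f z.1 z.2.1 z.2.2 :=
  hf.comp_continuous
    (by fun_prop : Continuous fun z : Vec d × Vec m × ℝ => (z.1, z.2.1, max 0 (min T z.2.2)))
    fun _ => ⟨mem_univ _, mem_univ _, clamp_mem_Icc hT _⟩

lemma lipschitzOnBounded_clampTime :
    LipschitzOnBounded T q (clampTime T θ) ↔ LipschitzOnBounded T q θ := by
  have h (x : ℝ → Vec d) (u : ℝ → Vec m) :
      ∫ t in Ioc 0 T, clampTime T θ (x t) (u t) t = ∫ t in Ioc 0 T, θ (x t) (u t) t :=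
    setIntegral_congr_fun measurableSet_Ioc fun t ht =>
      clampTime_of_mem θ _ _ (Ioc_subset_Icc_self ht)
  simp only [LipschitzOnBounded, IsLipschitzConstOnBall, h]

lemma GrowthOne.clampTime (hθ : GrowthOne T q θ) : GrowthOne T q (clampTime T θ) := by
  intro R hR
  obtain ⟨C, hC, ω, hω, hω0, hb⟩ := hθ R hR
  refine ⟨C, hC, ω, hω, hω0, ?_⟩
  filter_upwards [hb, ae_muT_mem_Icc T] with t h1 ht a b ha
  rw [clampTime_of_mem θ a b ht]
  exact h1 a b ha

lemma gradientGrowth_clampTime :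
    GradientGrowth T q q' (clampTime T θx) (clampTime T θu) ↔ GradientGrowth T q q' θx θu := by
  have h (C : ℝ) (ω η : ℝ → ℝ) (R : ℝ) : (∀ᵐ t ∂(muT T), ∀ (a : Vec d) (b : Vec m), ‖a‖ ≤ R →
      ‖clampTime T θx a b t‖ ≤ C * ‖b‖ ^ q + ω t ∧
        ‖clampTime T θu a b t‖ ≤ C * ‖b‖ ^ (q - 1) + η t) ↔
      ∀ᵐ t ∂(muT T), ∀ (a : Vec d) (b : Vec m), ‖a‖ ≤ R →
        ‖θx a b t‖ ≤ C * ‖b‖ ^ q + ω t ∧ ‖θu a b t‖ ≤ C * ‖b‖ ^ (q - 1) + η t := by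
    refine eventually_congr ((ae_muT_mem_Icc T).mono fun t ht => ?_)
    simp only [clampTime_of_mem _ _ _ ht]
  simp only [GradientGrowth, h]

end Main

/-- Proposition B.2: let `1 ≤ q < ∞` with conjugate exponent `q'`, `θ` be continuous and
differentiable in `x` and `u` with continuous gradients `∇_x θ` and `∇_u θ`, and satisfy the growth
condition of order `(q,1)`.  Then the functional `I(x,u) = ∫₀^T θ(x(t),u(t),t) dt` is Lipschitz
continuous on every bounded subset of `L^∞_d(0,T) × L^q_m(0,T)` if and only if `∇_x θ` satisfies
the growth condition of order `(q,1)` and `∇_u θ` the growth condition of order `(q−1, q')`. -/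
theorem integral_functional_lipschitz_iff_gradient_growth {d m : ℕ} (T : ℝ) (hT : 0 < T)
    (q : ℝ) (hq : 1 ≤ q) (q' : ℝ≥0∞) (hq' : (ENNReal.ofReal q)⁻¹ + q'⁻¹ = 1)
    (θ : Vec d → Vec m → ℝ → ℝ)
    (θx : Vec d → Vec m → ℝ → Vec d) (θu : Vec d → Vec m → ℝ → Vec m)
    (hθc : ContinuousOn (fun z : Vec d × Vec m × ℝ => θ z.1 z.2.1 z.2.2)
      (Set.univ ×ˢ Set.univ ×ˢ Set.Icc 0 T))
    (hθx : ∀ (b : Vec m) (t : ℝ), t ∈ Set.Icc 0 T → ∀ a : Vec d,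
      HasGradientAt (fun a' => θ a' b t) (θx a b t) a)
    (hθu : ∀ (a : Vec d) (t : ℝ), t ∈ Set.Icc 0 T → ∀ b : Vec m,
      HasGradientAt (fun b' => θ a b' t) (θu a b t) b)
    (hθxc : ContinuousOn (fun z : Vec d × Vec m × ℝ => θx z.1 z.2.1 z.2.2)
      (Set.univ ×ˢ Set.univ ×ˢ Set.Icc 0 T))
    (hθuc : ContinuousOn (fun z : Vec d × Vec m × ℝ => θu z.1 z.2.1 z.2.2)
      (Set.univ ×ˢ Set.univ ×ˢ Set.Icc 0 T))
    (hθgrowth : ∀ R : ℝ, 0 < R → ∃ C : ℝ, 0 < C ∧ ∃ ω : ℝ → ℝ,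
      Integrable ω (muT T) ∧ (∀ᵐ t ∂(muT T), 0 ≤ ω t) ∧
      ∀ᵐ t ∂(muT T), ∀ (a : Vec d) (b : Vec m), ‖a‖ ≤ R →
        |θ a b t| ≤ C * ‖b‖ ^ q + ω t) :
    -- Lipschitz continuity on every bounded subset of `L^∞ × L^q` ...
    (∀ r : ℝ, 0 < r → ∃ L : ℝ, 0 ≤ L ∧
      ∀ (x y : ℝ → Vec d) (u v : ℝ → Vec m),
        MemLp x ⊤ (muT T) → MemLp u (ENNReal.ofReal q) (muT T) →
        MemLp y ⊤ (muT T) → MemLp v (ENNReal.ofReal q) (muT T) →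
        (eLpNorm x ⊤ (muT T)).toReal + (eLpNorm u (ENNReal.ofReal q) (muT T)).toReal ≤ r →
        (eLpNorm y ⊤ (muT T)).toReal + (eLpNorm v (ENNReal.ofReal q) (muT T)).toReal ≤ r →
        |(∫ t in Set.Ioc (0:ℝ) T, θ (x t) (u t) t) - ∫ t in Set.Ioc (0:ℝ) T, θ (y t) (v t) t|
          ≤ L * ((eLpNorm (fun t => x t - y t) ⊤ (muT T)).toReal +
              (eLpNorm (fun t => u t - v t) (ENNReal.ofReal q) (muT T)).toReal)) ↔
    -- ... iff the gradients satisfy the growth conditions of orders `(q,1)` and `(q−1,q')`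
    (∀ R : ℝ, 0 < R → ∃ C : ℝ, 0 < C ∧ ∃ ω η : ℝ → ℝ,
      Integrable ω (muT T) ∧ (∀ᵐ t ∂(muT T), 0 ≤ ω t) ∧
      MemLp η q' (muT T) ∧ (∀ᵐ t ∂(muT T), 0 ≤ η t) ∧
      ∀ᵐ t ∂(muT T), ∀ (a : Vec d) (b : Vec m), ‖a‖ ≤ R →
        ‖θx a b t‖ ≤ C * ‖b‖ ^ q + ω t ∧ ‖θu a b t‖ ≤ C * ‖b‖ ^ (q - 1) + η t) := by
  change LipschitzOnBounded T q θ ↔ GradientGrowth T q q' θx θu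
  rw [← lipschitzOnBounded_clampTime, ← gradientGrowth_clampTime]
  have hc := continuous_clampTime hT.le hθc
  have hx (a : Vec d) (b : Vec m) (t : ℝ) :
      HasGradientAt (fun a' => clampTime T θ a' b t) (clampTime T θx a b t) a :=
    hθx b _ (clamp_mem_Icc hT.le t) a
  have hu (a : Vec d) (b : Vec m) (t : ℝ) :
      HasGradientAt (fun b' => clampTime T θ a b' t) (clampTime T θu a b t) b :=
    hθu a _ (clamp_mem_Icc hT.le t) b
  exact ⟨fun h => h.gradientGrowth hT hq hq' hc hx hu (continuous_clampTime hT.le hθxc)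
      (continuous_clampTime hT.le hθuc),
    fun h => h.lipschitzOnBounded hq hq' hc hx hu (GrowthOne.clampTime hθgrowth)⟩
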